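/- arXiv:2401.13612 — 2 statements merged into one kernel-verified Lean document; each statement's English description precedes it below -/
import Mathlib

section
/- Fix an integer n ≥ 2 and an orientation word o : ZMod n → ℤ with o(i) ∈ {−1, 1} for all i, such that both values occur, i.e. n₊(o) ≥ 1 and n₋(o) ≥ 1. Then there exists K < n_bal(o) such that for every k ≥ K the iterate Fᵏ o is interlaced, i.e. its set of meeting indices has cardinality exactly n_bal(o). In words: the round dynamics reaches an interlaced configuration in fewer than n_bal(o) rounds and remains interlaced forever after. -/
/-- `i` is a meeting index of the orientation word `o`: `o i = 1` and
`o (i+1) = -1`. -/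
def IsMeeting {n : ℕ} (o : ZMod n → ℤ) (i : ZMod n) : Prop :=
  o i = 1 ∧ o (i + 1) = -1

instance {n : ℕ} (o : ZMod n → ℤ) (i : ZMod n) : Decidable (IsMeeting o i) := by
  unfold IsMeeting; infer_instance

/-- The round map `F`: each adjacent pair oriented `(+1, -1)` meets and both
members reverse their orientation; all other orientations are unchanged. -/
def roundMap {n : ℕ} (o : ZMod n → ℤ) : ZMod n → ℤ := fun i =>
  if IsMeeting o i then -1
  else if IsMeeting o (i - 1) then 1
  else o i

/-- The set of meeting indices of `o`. -/
def meetSet {n : ℕ} [NeZero n] (o : ZMod n → ℤ) : Finset (ZMod n) :=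
  Finset.univ.filter (IsMeeting o)

/-- The number of indices with orientation `+1`. -/
def nPlus {n : ℕ} [NeZero n] (o : ZMod n → ℤ) : ℕ :=
  (Finset.univ.filter (fun i => o i = 1)).card

/-- The number of indices with orientation `-1`. -/
def nMinus {n : ℕ} [NeZero n] (o : ZMod n → ℤ) : ℕ :=
  (Finset.univ.filter (fun i => o i = -1)).card

/-- `n_bal = min(n₊, n₋)`. -/
def nBal {n : ℕ} [NeZero n] (o : ZMod n → ℤ) : ℕ :=
  min (nPlus o) (nMinus o)

/-- An orientation word is interlaced when its number of meeting indices equals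
`n_bal`. -/
def IsInterlaced {n : ℕ} [NeZero n] (o : ZMod n → ℤ) : Prop :=
  (meetSet o).card = nBal o

section RoundMap

variable {n : ℕ}

/-- The orientation word read backwards with both orientations exchanged. -/
def reflectWord (o : ZMod n → ℤ) : ZMod n → ℤ := fun i => -o (-i)

theorem isMeeting_reflectWord_iff (o : ZMod n → ℤ) (i : ZMod n) :
    IsMeeting (reflectWord o) i ↔ IsMeeting o (-i - 1) := by
  have h : -(i + 1) = -i - 1 := by ring
  simp only [IsMeeting, reflectWord, h, sub_add_cancel, neg_inj]
  constructor <;> rintro ⟨h₁, h₂⟩ <;> constructor <;> omega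

theorem roundMap_reflectWord (o : ZMod n → ℤ) :
    roundMap (reflectWord o) = reflectWord (roundMap o) := by
  funext i
  have h : -(i - 1) - 1 = -i := by ring
  simp only [roundMap, isMeeting_reflectWord_iff, h]
  simp only [reflectWord, roundMap]
  by_cases h₁ : IsMeeting o (-i - 1)
  · have h₂ : ¬ IsMeeting o (-i) := fun h₂ => by
      have := h₁.2
      rw [sub_add_cancel, h₂.1] at this
      omega
    simp [h₁, h₂]
  · by_cases h₂ : IsMeeting o (-i) <;> simp [h₁, h₂]

theorem iterate_roundMap_reflectWord (o : ZMod n → ℤ) (k : ℕ) :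
    roundMap^[k] (reflectWord o) = reflectWord (roundMap^[k] o) :=
  ((show Function.Semiconj reflectWord roundMap roundMap from
    fun o => (roundMap_reflectWord o).symm).iterate_right k o).symm

theorem roundMap_eq_neg_one_or_one {o : ZMod n → ℤ} (ho : ∀ i, o i = -1 ∨ o i = 1)
    (i : ZMod n) : roundMap o i = -1 ∨ roundMap o i = 1 := by
  unfold roundMap
  split_ifs <;> simp [ho i]

theorem iterate_roundMap_eq_neg_one_or_one {o : ZMod n → ℤ}
    (ho : ∀ i, o i = -1 ∨ o i = 1) (k : ℕ) (i : ZMod n) :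
    roundMap^[k] o i = -1 ∨ roundMap^[k] o i = 1 := by
  induction k generalizing i with
  | zero => exact ho i
  | succ k ih =>
    rw [Function.iterate_succ_apply']
    exact roundMap_eq_neg_one_or_one ih i

theorem roundMap_eq_sub_add (o : ZMod n → ℤ) (i : ZMod n) :
    roundMap o i = o i - (if IsMeeting o i then 2 else 0)
      + (if IsMeeting o (i - 1) then 2 else 0) := by
  by_cases h₁ : IsMeeting o i
  · have h₂ : ¬ IsMeeting o (i - 1) := fun h₂ => by
      have := h₂.2
      rw [sub_add_cancel, h₁.1] at this
      omega
    simp [roundMap, h₁, h₂, h₁.1]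
  · by_cases h₂ : IsMeeting o (i - 1)
    · have := h₂.2
      rw [sub_add_cancel] at this
      simp [roundMap, h₁, h₂, this]
    · simp [roundMap, h₁, h₂]

/-- Two adjacent `+1` after a round come from two adjacent `+1` one step to the right. -/
theorem eq_one_of_roundMap_eq_one {o : ZMod n → ℤ} (ho : ∀ i, o i = -1 ∨ o i = 1)
    {i : ZMod n} (h₀ : roundMap o i = 1) (h₁ : roundMap o (i + 1) = 1) :
    o (i + 1) = 1 ∧ o (i + 1 + 1) = 1 := by
  simp only [roundMap, IsMeeting, add_sub_cancel_right, sub_add_cancel] at h₀ h₁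
  grind

/-- The sum over a window changes in a round only through meetings at its two ends. -/
theorem sum_range_roundMap (o : ZMod n → ℤ) (a : ZMod n) (m : ℕ) :
    ∑ j ∈ Finset.range m, roundMap o (a + j) = ∑ j ∈ Finset.range m, o (a + j)
      + (if IsMeeting o (a - 1) then 2 else 0)
      - (if IsMeeting o (a + m - 1) then 2 else 0) := by
  induction m with
  | zero => simp
  | succ m ih =>
    rw [Finset.sum_range_succ, Finset.sum_range_succ, ih, roundMap_eq_sub_add]
    have h : a + ((m + 1 : ℕ) : ZMod n) - 1 = a + m := by push_cast; ring
    rw [h]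
    ring

theorem two_le_sum_range_of_iterate_roundMap_eq_one {o : ZMod n → ℤ}
    (ho : ∀ i, o i = -1 ∨ o i = 1) (t : ℕ) {i : ZMod n}
    (h₀ : roundMap^[t] o i = 1) (h₁ : roundMap^[t] o (i + 1) = 1) :
    (o (i + t) = 1 ∧ o (i + t + 1) = 1) ∧
      2 ≤ ∑ j ∈ Finset.range (2 * t + 2), o (i - t + j) := by
  induction t generalizing o with
  | zero =>
    simp only [Function.iterate_zero, id_eq] at h₀ h₁
    simp [Finset.sum_range_succ, h₀, h₁]
  | succ t ih =>
    rw [Function.iterate_succ_apply] at h₀ h₁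
    obtain ⟨⟨h₂, h₃⟩, h₄⟩ := ih (roundMap_eq_neg_one_or_one ho) h₀ h₁
    have h₅ := eq_one_of_roundMap_eq_one ho h₂ h₃
    have e : i + ((t + 1 : ℕ) : ZMod n) = i + t + 1 := by push_cast; ring
    refine ⟨by rwa [e], ?_⟩
    rw [sum_range_roundMap] at h₄
    have hr : i - t + ((2 * t + 2 : ℕ) : ZMod n) - 1 = i + t + 1 := by push_cast; ring
    have hn : ¬ IsMeeting o (i + t + 1) := fun h => by
      have := h.2
      omega
    rw [hr, if_neg hn] at h₄
    rw [show 2 * (t + 1) + 2 = 2 * t + 2 + 1 + 1 by ring, Finset.sum_range_succ,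
      Finset.sum_range_succ']
    have hs : ∀ j : ℕ, i - ((t + 1 : ℕ) : ZMod n) + ((j + 1 : ℕ) : ZMod n) = i - t + j :=
      fun j => by push_cast; ring
    have hl : i - ((t + 1 : ℕ) : ZMod n) + ((0 : ℕ) : ZMod n) = i - t - 1 := by
      push_cast; ring
    have hr' : i - (t : ZMod n) + ((2 * t + 2 : ℕ) : ZMod n) = i + t + 1 + 1 := by
      push_cast; ring
    simp only [hs]
    rw [hl, hr', h₅.2]
    split_ifs at h₄ with hm
    · have := hm.1
      omega
    · have := ho (i - t - 1)
      omega

theorem sum_eq_two_mul_card_sub {o : ZMod n → ℤ} (ho : ∀ i, o i = -1 ∨ o i = 1)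
    (s : Finset (ZMod n)) :
    ∑ i ∈ s, o i = 2 * ((s.filter fun i => o i = 1).card : ℤ) - s.card := by
  have h : ∀ i ∈ s, o i = 2 * (if o i = 1 then 1 else 0) - 1 := fun i _ => by
    rcases ho i with h | h <;> simp [h]
  rw [Finset.sum_congr rfl h, Finset.sum_sub_distrib, ← Finset.mul_sum]
  simp

variable [NeZero n]

theorem meetSet_card_reflectWord (o : ZMod n → ℤ) :
    (meetSet (reflectWord o)).card = (meetSet o).card := by
  refine Finset.card_bij' (fun i _ => -i - 1) (fun i _ => -i - 1) ?_ ?_ ?_ ?_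
  · simp [meetSet, isMeeting_reflectWord_iff]
  · simp [meetSet, isMeeting_reflectWord_iff]
  · intros; ring
  · intros; ring

theorem nPlus_reflectWord (o : ZMod n → ℤ) : nPlus (reflectWord o) = nMinus o := by
  refine Finset.card_bij' (fun i _ => -i) (fun i _ => -i) ?_ ?_ ?_ ?_ <;>
    simp [reflectWord, neg_eq_iff_eq_neg]

theorem nMinus_reflectWord (o : ZMod n → ℤ) : nMinus (reflectWord o) = nPlus o := by
  refine Finset.card_bij' (fun i _ => -i) (fun i _ => -i) ?_ ?_ ?_ ?_ <;>
    simp [reflectWord]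

theorem nBal_reflectWord (o : ZMod n → ℤ) : nBal (reflectWord o) = nBal o := by
  rw [nBal, nPlus_reflectWord, nMinus_reflectWord, min_comm, nBal]

theorem isInterlaced_reflectWord_iff (o : ZMod n → ℤ) :
    IsInterlaced (reflectWord o) ↔ IsInterlaced o := by
  rw [IsInterlaced, IsInterlaced, meetSet_card_reflectWord, nBal_reflectWord]

theorem nPlus_add_nMinus {o : ZMod n → ℤ} (ho : ∀ i, o i = -1 ∨ o i = 1) :
    nPlus o + nMinus o = n := by
  have h : (Finset.univ.filter fun i => o i = -1) = Finset.univ.filter fun i => ¬ o i = 1 := by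
    refine Finset.filter_congr fun i _ => ?_
    have := ho i
    omega
  rw [nPlus, nMinus, h, Finset.card_filter_add_card_filter_not, Finset.card_univ, ZMod.card]

theorem sum_roundMap (o : ZMod n → ℤ) : ∑ i, roundMap o i = ∑ i, o i := by
  simp only [roundMap_eq_sub_add, Finset.sum_add_distrib, Finset.sum_sub_distrib]
  have h := (Equiv.subRight (1 : ZMod n)).sum_comp fun i => if IsMeeting o i then (2 : ℤ) else 0
  simp only [Equiv.subRight_apply] at h
  rw [h]
  ring

theorem nPlus_roundMap {o : ZMod n → ℤ} (ho : ∀ i, o i = -1 ∨ o i = 1) :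
    nPlus (roundMap o) = nPlus o := by
  have h := sum_roundMap o
  rw [sum_eq_two_mul_card_sub ho,
    sum_eq_two_mul_card_sub (roundMap_eq_neg_one_or_one ho)] at h
  unfold nPlus
  omega

theorem nPlus_iterate_roundMap {o : ZMod n → ℤ} (ho : ∀ i, o i = -1 ∨ o i = 1) (k : ℕ) :
    nPlus (roundMap^[k] o) = nPlus o := by
  induction k with
  | zero => rfl
  | succ k ih =>
    rw [Function.iterate_succ_apply',
      nPlus_roundMap (iterate_roundMap_eq_neg_one_or_one ho k), ih]

theorem sum_range_le_of_le {o : ZMod n → ℤ} (ho : ∀ i, o i = -1 ∨ o i = 1)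
    (a : ZMod n) {m : ℕ} (hm : m ≤ n) :
    ∑ j ∈ Finset.range m, o (a + j) ≤ 2 * (nPlus o : ℤ) - m := by
  have hinj : Set.InjOn (fun j : ℕ => a + (j : ZMod n)) (Finset.range m) := by
    intro x hx y hy hxy
    rw [Finset.coe_range, Set.mem_Iio] at hx hy
    have h := congrArg ZMod.val (add_left_cancel hxy)
    rwa [ZMod.val_natCast_of_lt (by omega), ZMod.val_natCast_of_lt (by omega)] at h
  rw [← Finset.sum_image (f := o) hinj, sum_eq_two_mul_card_sub ho,
    Finset.card_image_of_injOn hinj, Finset.card_range]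
  have : (((Finset.range m).image fun j : ℕ => a + (j : ZMod n)).filter
      fun i => o i = 1).card ≤ nPlus o :=
    Finset.card_le_card (Finset.filter_subset_filter _ (Finset.subset_univ _))
  omega

theorem isInterlaced_of_forall_eq_neg_one {o : ZMod n → ℤ} (hle : nPlus o ≤ nMinus o)
    (h : ∀ i, o i = 1 → o (i + 1) = -1) : IsInterlaced o := by
  rw [IsInterlaced, nBal, min_eq_left hle, meetSet, nPlus]
  exact congrArg _ (Finset.filter_congr fun i _ => ⟨fun hi => hi.1, fun hi => ⟨hi, h i hi⟩⟩)

theorem isInterlaced_iterate_roundMap {o : ZMod n → ℤ} (ho : ∀ i, o i = -1 ∨ o i = 1)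
    (hplus : 1 ≤ nPlus o) (hle : nPlus o ≤ nMinus o) {k : ℕ} (hk : nPlus o - 1 ≤ k) :
    IsInterlaced (roundMap^[k] o) := by
  have hn := nPlus_add_nMinus ho
  have hk' := iterate_roundMap_eq_neg_one_or_one ho k
  refine isInterlaced_of_forall_eq_neg_one ?_ fun i hi => (hk' (i + 1)).resolve_right fun hi' => ?_
  · have := nPlus_add_nMinus hk'
    have := nPlus_iterate_roundMap ho k
    omega
  · obtain ⟨d, rfl⟩ := Nat.exists_eq_add_of_le hk
    rw [Function.iterate_add_apply] at hi hi'
    have hd := iterate_roundMap_eq_neg_one_or_one ho d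
    have h₁ := (two_le_sum_range_of_iterate_roundMap_eq_one hd _ hi hi').2
    have h₂ := sum_range_le_of_le hd (i - ((nPlus o - 1 : ℕ) : ZMod n))
      (m := 2 * (nPlus o - 1) + 2) (by omega)
    rw [nPlus_iterate_roundMap ho d] at h₂
    omega

end RoundMap

/-- if both orientations occur, the round dynamics reaches an
interlaced configuration in fewer than `n_bal(o)` rounds and remains interlaced
forever after. -/
theorem roundMap_reaches_interlaced {n : ℕ} (hn : 2 ≤ n) [NeZero n]
    (o : ZMod n → ℤ) (ho : ∀ i, o i = -1 ∨ o i = 1)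
    (hplus : 1 ≤ nPlus o) (hminus : 1 ≤ nMinus o) :
    ∃ K, K < nBal o ∧ ∀ k, K ≤ k → IsInterlaced (roundMap^[k] o) := by
  refine ⟨nBal o - 1, by unfold nBal; omega, fun k hk => ?_⟩
  rcases le_total (nPlus o) (nMinus o) with hle | hle
  · rw [nBal, min_eq_left hle] at hk
    exact isInterlaced_iterate_roundMap ho hplus hle hk
  · rw [nBal, min_eq_right hle] at hk
    rw [← isInterlaced_reflectWord_iff, ← iterate_roundMap_reflectWord]
    refine isInterlaced_iterate_roundMap (fun i => ?_) ?_ ?_ ?_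
    · have := ho (-i)
      unfold reflectWord
      omega
    · rwa [nPlus_reflectWord]
    · rwa [nPlus_reflectWord, nMinus_reflectWord]
    · rwa [nPlus_reflectWord]
end

section
/- (Move+ rule) Fix an integer n ≥ 2, an orientation word o : ZMod n → ℤ with o(i) ∈ {−1, 1}, an index j ∈ ZMod n, and an even integer l with 2 ≤ l and l + 2 ≤ n. Suppose o(j−1) = 1, o(j+m) = (−1)ᵐ for m = 0,…,l−1 (an alternating sequence of length l starting with +1 at position j), and o(j+l) = 1. Then (F o)(j−1+m) = (−1)ᵐ for m = 0,…,l−1 (the alternating sequence of length l now starts at position j−1) and (F o)(j+l−1) = 1: the sequence moves one position to the left, consuming the +1 to its left and leaving a +1 to its right. -/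
theorem IsMeeting.roundMap_eq {n : ℕ} {o : ZMod n → ℤ} {i : ZMod n} (h : IsMeeting o i) :
    roundMap o i = -1 := by
  simp [roundMap, h]

theorem IsMeeting.roundMap_add_one {n : ℕ} {o : ZMod n → ℤ} {i : ZMod n} (h : IsMeeting o i) :
    roundMap o (i + 1) = 1 := by
  have h' : ¬ IsMeeting o (i + 1) := fun hm => by
    have := hm.1.symm.trans h.2
    norm_num at this
  simp [roundMap, h, h']

theorem roundMap_eq_one_of_eq_one {n : ℕ} {o : ZMod n → ℤ} {i : ZMod n}
    (h : o i = 1) (h' : o (i + 1) = 1) : roundMap o i = 1 := by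
  simp [roundMap, IsMeeting, h, h']

/-- Move+ rule: `+ [seq, l] +` becomes `[seq, l] + +` under one
round of the dynamics: the alternating sequence moves one position left. -/
theorem roundMap_movePlus_rule {n : ℕ} (hn : 2 ≤ n) [NeZero n]
    (o : ZMod n → ℤ) (ho : ∀ i, o i = -1 ∨ o i = 1)
    (j : ZMod n) (l : ℕ) (hl2 : 2 ≤ l) (hle : Even l) (hln : l + 2 ≤ n)
    (hleft : o (j - 1) = 1)
    (hseq : ∀ m : ℕ, m < l → o (j + (m : ZMod n)) = (-1) ^ m)
    (hright : o (j + (l : ZMod n)) = 1) :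
    (∀ m : ℕ, m < l → roundMap o (j - 1 + (m : ZMod n)) = (-1) ^ m) ∧
    roundMap o (j + (l : ZMod n) - 1) = 1 := by
  have meet : ∀ k : ℕ, Even k → k + 1 < l → IsMeeting o (j + (k : ZMod n)) := by
    intro k hk hkl
    refine ⟨by rw [hseq k (by omega), hk.neg_one_pow], ?_⟩
    have h := hseq (k + 1) hkl
    rwa [hk.add_one.neg_one_pow, Nat.cast_add_one, ← add_assoc] at h
  have after_meet : ∀ k : ℕ, Even k → k + 1 < l →
      roundMap o (j + (k : ZMod n) + 1) = 1 :=
    fun k hk hkl => (meet k hk hkl).roundMap_add_one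
  constructor
  · intro m hm
    obtain _ | k := m
    · have h0 := hseq 0 (by omega)
      simp only [Nat.cast_zero, add_zero, pow_zero] at h0 ⊢
      exact roundMap_eq_one_of_eq_one hleft (by rwa [sub_add_cancel])
    · rw [show j - 1 + ((k + 1 : ℕ) : ZMod n) = j + (k : ZMod n) by push_cast; ring]
      rcases Nat.even_or_odd k with hk | hk
      · rw [(meet k hk hm).roundMap_eq, hk.add_one.neg_one_pow]
      · obtain ⟨r, rfl⟩ := hk
        rw [(odd_two_mul_add_one r).add_one.neg_one_pow, Nat.cast_add_one, ← add_assoc]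
        exact after_meet (2 * r) (even_two_mul r) (by omega)
  · obtain ⟨k, rfl⟩ := Nat.exists_eq_add_of_le' hl2
    rw [show j + ((k + 2 : ℕ) : ZMod n) - 1 = j + (k : ZMod n) + 1 by push_cast; ring]
    exact after_meet k (by simpa [Nat.even_add] using hle) (by omega)
end
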